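/- arXiv:2412.04511 — 2 statements merged into one kernel-verified Lean document; each statement's English description precedes it below -/
import Mathlib

section
/- Let k be an algebraically closed field, A a k-algebra, and V an indecomposable left A-module that is finite-dimensional as a k-vector space, with a composition series 0 = V_0 ⊂ V_1 ⊂ ⋯ ⊂ V_ℓ = V. Then for each j ∈ {1, …, ℓ}, the annihilator in the center Z(A) of the composition factor V_j/V_{j−1} equals the annihilator in Z(A) of V_1, i.e. ann_{Z(A)}(V_j/V_{j−1}) = ann_{Z(A)}(V_1). -/
universe u v w

section

variable {A : Type*} [Ring A] {V : Type*} [AddCommGroup V] [Module A V]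

/-- Multiplication by a central element, as an endomorphism of a module. -/
def centralSMul (V : Type*) [AddCommGroup V] [Module A V] (z : Subring.center A) :
    Module.End A V where
  toFun x := (z : A) • x
  map_add' := smul_add _
  map_smul' a x := by
    rw [RingHom.id_apply, smul_smul, smul_smul, Subring.mem_center_iff.mp z.2 a]

@[simp]
theorem centralSMul_apply (z : Subring.center A) (x : V) :
    centralSMul V z x = (z : A) • x := rfl

theorem centralSMul_pow_apply (z : Subring.center A) (n : ℕ) (x : V) :
    (centralSMul V z ^ n) x = (z : A) ^ n • x := by
  induction n with
  | zero => simp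
  | succ n ih =>
    rw [pow_succ', pow_succ', Module.End.mul_apply, ih, centralSMul_apply, smul_smul]

/-- Fitting's dichotomy: an endomorphism of an indecomposable module of finite length is
injective or nilpotent. -/
theorem Module.End.injective_or_isNilpotent_of_indecomposable
    [IsNoetherian A V] [IsArtinian A V]
    (hind : ∀ p q : Submodule A V, IsCompl p q → p = ⊥ ∨ q = ⊥) (f : Module.End A V) :
    Function.Injective f ∨ IsNilpotent f := by
  obtain ⟨n, hn⟩ := Filter.eventually_atTop.mp f.eventually_isCompl_ker_pow_range_pow
  rcases hind _ _ (hn (n + 1) n.le_succ) with h | h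
  · left
    rw [LinearMap.ker_eq_bot, pow_succ, Module.End.mul_eq_comp, LinearMap.coe_comp] at h
    exact h.of_comp
  · exact Or.inr ⟨n + 1, LinearMap.range_eq_bot.mp h⟩

theorem mem_annihilator_center_subquotient_iff {p q : Submodule A V} {z : Subring.center A} :
    z ∈ Module.annihilator (Subring.center A) (q ⧸ p.comap q.subtype) ↔
      ∀ x ∈ q, (z : A) • x ∈ p := by
  rw [Module.mem_annihilator]
  constructor
  · intro h x hx
    exact (Submodule.Quotient.mk_eq_zero (p.comap q.subtype) (x := (z : A) • (⟨x, hx⟩ : q))).mp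
      (h (Submodule.Quotient.mk ⟨x, hx⟩))
  · intro h m
    obtain ⟨x, rfl⟩ := Submodule.Quotient.mk_surjective _ m
    exact (Submodule.Quotient.mk_eq_zero _).mpr (h x x.2)

/-- On an indecomposable module of finite length, a central element annihilates a given
simple subquotient if and only if it acts nilpotently. -/
theorem mem_annihilator_center_subquotient_iff_isNilpotent
    [IsNoetherian A V] [IsArtinian A V]
    (hind : ∀ p q : Submodule A V, IsCompl p q → p = ⊥ ∨ q = ⊥)
    {p q : Submodule A V} (hpq : p < q) (hsimple : IsSimpleModule A (q ⧸ p.comap q.subtype))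
    {z : Subring.center A} :
    z ∈ Module.annihilator (Subring.center A) (q ⧸ p.comap q.subtype) ↔
      IsNilpotent (centralSMul V z) := by
  constructor
  · intro h
    rw [mem_annihilator_center_subquotient_iff] at h
    refine (Module.End.injective_or_isNilpotent_of_indecomposable hind _).resolve_left
      fun hinj ↦ hpq.not_ge fun x hx ↦ ?_
    have hinj' : Function.Injective (centralSMul q z) := fun a b hab ↦
      Subtype.ext (hinj (congrArg Subtype.val hab))
    obtain ⟨y, hy⟩ := IsArtinian.surjective_of_injective_endomorphism _ hinj' ⟨x, hx⟩
    have hyx : (z : A) • (y : V) = x := congrArg Subtype.val hy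
    exact hyx ▸ h y y.2
  · rintro ⟨n, hn⟩
    have hnil : IsNilpotent (centralSMul (q ⧸ p.comap q.subtype) z) := by
      refine ⟨n, LinearMap.ext fun m ↦ ?_⟩
      obtain ⟨x, rfl⟩ := Submodule.Quotient.mk_surjective _ m
      have hx : (z : A) ^ n • x = 0 := Subtype.ext <| by
        simpa [centralSMul_pow_apply] using LinearMap.congr_fun hn (x : V)
      rw [centralSMul_pow_apply, ← Submodule.Quotient.mk_smul, hx]
      rfl
    classical
    exact Module.mem_annihilator.mpr (LinearMap.congr_fun hnil.eq_zero)

end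

/-- For an indecomposable finite-dimensional module `V` over a `k`-algebra `A` (`k`
algebraically closed) with a composition series `0 = V_0 ⊂ V_1 ⊂ ⋯ ⊂ V_ℓ = V`, the
annihilator in the center `Z(A)` of each composition factor `V_j/V_{j-1}` equals the
annihilator in `Z(A)` of `V_1`. -/
theorem annihilator_center_compositionFactor_eq
    {k : Type u} [Field k] [IsAlgClosed k]
    {A : Type v} [Ring A] [Algebra k A]
    {V : Type w} [AddCommGroup V] [Module k V] [Module A V]
    [IsScalarTower k A V] [FiniteDimensional k V]
    [Nontrivial V]
    (hind : ∀ p q : Submodule A V, IsCompl p q → p = ⊥ ∨ q = ⊥)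
    (ℓ : ℕ) (hℓ : 0 < ℓ) (c : Fin (ℓ + 1) → Submodule A V)
    (hbot : c 0 = ⊥) (htop : c (Fin.last ℓ) = ⊤)
    (hlt : ∀ j : Fin ℓ, c j.castSucc < c j.succ)
    (hsimple : ∀ j : Fin ℓ,
      IsSimpleModule A
        (↥(c j.succ) ⧸ Submodule.comap (c j.succ).subtype (c j.castSucc))) :
    ∀ j : Fin ℓ,
      Module.annihilator (Subring.center A)
          (↥(c j.succ) ⧸ Submodule.comap (c j.succ).subtype (c j.castSucc)) =
        Module.annihilator (Subring.center A) ↥(c ⟨1, Nat.succ_lt_succ hℓ⟩) := by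
  have hN : IsNoetherian A V := isNoetherian_of_tower k inferInstance
  have hA : IsArtinian A V := isArtinian_of_tower k inferInstance
  intro j
  have hfirst : ∀ z : Subring.center A,
      z ∈ Module.annihilator (Subring.center A) ↥(c ⟨1, Nat.succ_lt_succ hℓ⟩) ↔
        IsNilpotent (centralSMul V z) := fun z ↦ by
    rw [← mem_annihilator_center_subquotient_iff_isNilpotent hind (hlt ⟨0, hℓ⟩)
      (hsimple ⟨0, hℓ⟩), mem_annihilator_center_subquotient_iff, Module.mem_annihilator]
    have h0 : c (Fin.castSucc ⟨0, hℓ⟩) = ⊥ := hbot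
    simp only [h0, Submodule.mem_bot]
    exact ⟨fun h x hx ↦ congrArg Subtype.val (h ⟨x, hx⟩),
      fun h x ↦ Subtype.ext (h x x.2)⟩
  ext z
  rw [hfirst, mem_annihilator_center_subquotient_iff_isNilpotent hind (hlt j) (hsimple j)]
end

section
/- Let k be an algebraically closed field, A a k-algebra, and e ∈ A an idempotent such that the corner algebra eAe is commutative. Let V be a simple left A-module that is finite-dimensional as a k-vector space. Then the k-vector subspace e·V = {e·v : v ∈ V} of V has k-dimension at most 1. -/
universe u v w

/-- A nonzero vector of a simple module generates it. -/
theorem exists_smul_eq_of_isSimpleModule {A : Type v} [Ring A] {V : Type w} [AddCommGroup V]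
    [Module A V] [IsSimpleModule A V] {v : V} (hv : v ≠ 0) (x : V) : ∃ a : A, a • v = x := by
  have hx : x ∈ Submodule.span A {v} := by
    rw [IsSimpleModule.span_singleton_eq_top A hv]
    exact Submodule.mem_top
  exact Submodule.mem_span_singleton.mp hx

/-- If `e` is an idempotent of a `k`-algebra `A` whose corner algebra `eAe` is commutative
(`k` algebraically closed) and `V` is a simple left `A`-module which is finite-dimensional
over `k`, then the subspace `e • V` has `k`-dimension at most `1`. -/
theorem finrank_corner_le_one_of_simple
    {k : Type u} [Field k] [IsAlgClosed k]
    {A : Type v} [Ring A] [Algebra k A]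
    {V : Type w} [AddCommGroup V] [Module k V] [Module A V]
    [IsScalarTower k A V] [SMulCommClass A k V] [FiniteDimensional k V]
    (e : A) (he : e * e = e)
    (hcomm : ∀ a b : A, (e * a * e) * (e * b * e) = (e * b * e) * (e * a * e))
    (hV : IsSimpleModule A V) :
    Module.finrank k ↥(LinearMap.range (DistribMulAction.toLinearMap k V e)) ≤ 1 := by
  set W := LinearMap.range (DistribMulAction.toLinearMap k V e)
  have fixed (x : W) : e • (x : V) = x := by
    obtain ⟨_, y, rfl⟩ := x
    change e • e • y = e • y
    rw [← mul_smul, he]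
  have corner_smul (a : A) (x : W) : (e * a * e) • (x : V) = e • a • (x : V) := by
    rw [mul_smul, mul_smul, fixed]
  have exists_corner {x : W} (hx : x ≠ 0) (y : W) : ∃ a : A, (e * a * e) • (x : V) = y := by
    obtain ⟨a, ha⟩ := exists_smul_eq_of_isSimpleModule (A := A)
      (Submodule.coe_eq_zero.not.mpr hx) (y : V)
    exact ⟨a, by rw [corner_smul, ha, fixed]⟩
  rcases subsingleton_or_nontrivial W with h | h
  · exact (Module.finrank_zero_of_subsingleton (R := k) (M := W)).trans_le zero_le_one
  have scalar (a : A) : ∃ μ : k, ∀ x : W, (e * a * e) • (x : V) = μ • (x : V) := by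
    let f : Module.End k W := (DistribMulAction.toLinearMap k V e).rangeRestrict ∘ₗ
      DistribSMul.toLinearMap k V a ∘ₗ W.subtype
    obtain ⟨μ, hμ⟩ := Module.End.exists_eigenvalue f
    obtain ⟨x, hx⟩ := hμ.exists_hasEigenvector
    have hxμ : (e * a * e) • (x : V) = μ • (x : V) := by
      rw [corner_smul]
      exact congrArg Subtype.val hx.apply_eq_smul
    refine ⟨μ, fun y ↦ ?_⟩
    obtain ⟨b, hb⟩ := exists_corner hx.2 y
    rw [← hb, ← mul_smul, hcomm, mul_smul, hxμ, smul_comm]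
  obtain ⟨x, hx⟩ := exists_ne (0 : W)
  refine finrank_le_one x fun y ↦ ?_
  obtain ⟨a, ha⟩ := exists_corner hx y
  obtain ⟨μ, hμ⟩ := scalar a
  exact ⟨μ, Subtype.ext ((hμ x).symm.trans ha)⟩
end
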